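/- Let X and Y be independent random vectors each uniformly distributed on the unit sphere {x ∈ ℝ³ : ‖x‖₂ = 1} (uniform surface measure). Then E‖X−Y‖₂ = 4/3. Moreover, each coordinate of X is uniformly distributed on [−1,1]; consequently the bound S(C,C) ≤ 2/3 for copulas on [0,1]³ is attained by the spherical symmetric copula obtained from the uniform distribution on the sphere by the coordinatewise rescaling x ↦ (x+1)/2. -/

import Mathlib

open MeasureTheory Set
open scoped ENNReal

/-- The Euclidean distance `‖x - y‖₂` on `ℝ^d`. -/
noncomputable def dist2 {d : ℕ} (x y : Fin d → ℝ) : ℝ := Real.sqrt (∑ i, (x i - y i) ^ 2)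

/-- `S(F,G) = ∫∫ ‖x-y‖₂ F(dx) G(dy)`. -/
noncomputable def S (d : ℕ) (F G : Measure (Fin d → ℝ)) : ℝ :=
  ∫ x, ∫ y, dist2 x y ∂G ∂F

/-- The surface measure (2-dimensional Hausdorff measure) on the unit sphere of `ℝ³`. -/
noncomputable def sphereSurf : Measure (EuclideanSpace ℝ (Fin 3)) :=
  (μH[2]).restrict (Metric.sphere (0 : EuclideanSpace ℝ (Fin 3)) 1)

/-- The uniform (normalized surface) distribution on the unit sphere
`{x ∈ ℝ³ : ‖x‖₂ = 1}`, as a measure on `Fin 3 → ℝ`. -/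
noncomputable def sphereUnif : Measure (Fin 3 → ℝ) :=
  (sphereSurf Set.univ)⁻¹ •
    Measure.map (fun x : EuclideanSpace ℝ (Fin 3) => (fun i => x i)) sphereSurf

/-- The uniform distribution on `[-1,1]`. -/
noncomputable def uniformSymm : Measure ℝ := (2 : ℝ≥0∞)⁻¹ • volume.restrict (Set.Icc (-1) 1)

/-- The trivariate spherical symmetric copula: the pushforward of the uniform
distribution on the unit sphere under the coordinatewise rescaling `x ↦ (x+1)/2`. -/
noncomputable def CCirc3 : Measure (Fin 3 → ℝ) :=
  Measure.map (fun x : Fin 3 → ℝ => fun i => (x i + 1) / 2) sphereUnif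

abbrev E3 := EuclideanSpace ℝ (Fin 3)

lemma sphere_fin : (μH[2] : Measure E3) (Metric.sphere 0 1) ≠ ⊤ := by
  let f : (Fin 2 → ℝ) → E3 := fun p => !₂[Real.sin (p 0) * Real.cos (p 1), Real.sin (p 0) * Real.sin (p 1), Real.cos (p 0)]
  let K : Set (Fin 2 → ℝ) := Set.Icc (fun _ => -4) (fun _ => 4)
  have hf : ContDiff ℝ 1 f := by
    rw [contDiff_piLp]
    intro i
    fin_cases i <;> simp [f] <;> fun_prop
  obtain ⟨C, hC⟩ := hf.contDiffOn.exists_lipschitzOnWith (s := K) (by norm_num) (convex_Icc _ _) isCompact_Icc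
  have hsub : Metric.sphere (0 : E3) 1 ⊆ f '' K := by
    intro x hx
    have hn : x 0 ^ 2 + x 1 ^ 2 + x 2 ^ 2 = 1 := by
      have : ‖x‖ = 1 := by simpa using hx
      have h2 := EuclideanSpace.norm_sq_eq x
      rw [this] at h2
      simp [Fin.sum_univ_three] at h2
      linarith
    set z : ℂ := ⟨x 0, x 1⟩ with hz
    have hzn : ‖z‖ = √(1 - x 2 ^ 2) := by
      rw [Complex.norm_def, Complex.normSq_apply]
      congr 1
      simp [hz]; nlinarith
    refine ⟨![Real.arccos (x 2), z.arg], ⟨?_, ?_⟩, ?_⟩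
    · intro i
      have := Real.arccos_nonneg (x 2)
      have := Complex.neg_pi_lt_arg z
      have := Real.pi_lt_four
      fin_cases i <;> simp <;> linarith
    · intro i
      have := Real.arccos_le_pi (x 2)
      have := Complex.arg_le_pi z
      have := Real.pi_lt_four
      fin_cases i <;> simp <;> linarith
    · have h0 : ‖z‖ * Real.cos z.arg = x 0 := Complex.norm_mul_cos_arg z
      have h1 : ‖z‖ * Real.sin z.arg = x 1 := Complex.norm_mul_sin_arg z
      rw [hzn] at h0 h1
      ext i
      fin_cases i
      · simp [f, Real.sin_arccos, h0]
      · simp [f, Real.sin_arccos, h1]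
      · simp [f]
        apply Real.cos_arccos <;> nlinarith [sq_nonneg (x 0), sq_nonneg (x 1)]
  have hv : (μH[2] : Measure (Fin 2 → ℝ)) = volume := by
    have := hausdorffMeasure_pi_real (ι := Fin 2)
    simpa using this
  have h1 := hC.hausdorffMeasure_image_le (d := 2) (by norm_num)
  rw [hv] at h1
  refine ne_top_of_le_ne_top ?_ ((measure_mono hsub).trans h1)
  refine ENNReal.mul_ne_top (by simp) ?_
  exact (isCompact_Icc.measure_lt_top).ne

lemma sphere_pos : (μH[2] : Measure E3) (Metric.sphere 0 1) ≠ 0 := by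
  let f : E3 → (Fin 2 → ℝ) := fun x => ![x 0, x 1]
  have hf : LipschitzWith 1 f := by
    apply LipschitzWith.of_dist_le_mul
    intro x y
    simp only [NNReal.coe_one, one_mul]
    rw [dist_pi_le_iff dist_nonneg]
    intro i
    rw [dist_eq_norm x y]
    have h0 := PiLp.norm_apply_le (x - y) 0
    have h1 := PiLp.norm_apply_le (x - y) 1
    fin_cases i
    · simpa [f, dist_eq_norm] using h0
    · simpa [f, dist_eq_norm] using h1
  have hv : (μH[2] : Measure (Fin 2 → ℝ)) = volume := by
    have := hausdorffMeasure_pi_real (ι := Fin 2)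
    simpa using this
  have h1 := hf.hausdorffMeasure_image_le (d := 2) (by norm_num) (Metric.sphere 0 1)
  rw [hv] at h1
  have hsub : Set.Icc (fun _ => 0) (fun _ => 1/2) ⊆ f '' Metric.sphere 0 1 := by
    intro p hp
    have a0 := hp.1 0
    have a1 := hp.1 1
    have b0 := hp.2 0
    have b1 := hp.2 1
    simp only at a0 a1 b0 b1
    refine ⟨!₂[p 0, p 1, √(1 - p 0 ^ 2 - p 1 ^ 2)], ?_, ?_⟩
    · have : 0 ≤ 1 - p 0 ^ 2 - p 1 ^ 2 := by nlinarith
      simp [EuclideanSpace.norm_eq, Fin.sum_univ_three, Real.sq_sqrt this]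
    · ext i
      fin_cases i <;> simp [f]
  intro h
  rw [h, mul_zero] at h1
  have := (measure_mono hsub).trans h1
  rw [Real.volume_Icc_pi] at this
  simp at this

noncomputable def sig : Measure E3 := (sphereSurf Set.univ)⁻¹ • sphereSurf

instance : IsProbabilityMeasure sig := by
  constructor
  have : sphereSurf Set.univ = (μH[2] : Measure E3) (Metric.sphere 0 1) := by simp [sphereSurf]
  simp only [sig, Measure.smul_apply, smul_eq_mul]
  rw [this]
  exact ENNReal.inv_mul_cancel sphere_pos sphere_fin

lemma sig_sphere : ∀ᵐ x ∂sig, ‖x‖ = 1 := by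
  have : ∀ᵐ x ∂sphereSurf, ‖x‖ = 1 := by
    filter_upwards [ae_restrict_mem (μ := (μH[2] : Measure E3)) (s := Metric.sphere 0 1) Metric.isClosed_sphere.measurableSet] with x hx
    simpa using hx
  exact Measure.ae_smul_measure this _

lemma sig_inv (R : E3 ≃ₗᵢ[ℝ] E3) : MeasurePreserving R sig sig := by
  refine MeasurePreserving.smul_measure ?_ _
  have h := (R.toIsometryEquiv.measurePreserving_hausdorffMeasure 2).restrict_preimage (s := Metric.sphere (0 : E3) 1) Metric.isClosed_sphere.measurableSet
  have h2 : R.toIsometryEquiv ⁻¹' (Metric.sphere (0 : E3) 1) = Metric.sphere 0 1 := by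
    ext x; simp
  rw [h2] at h
  exact h

lemma sig_int_inv (R : E3 ≃ₗᵢ[ℝ] E3) (f : E3 → ℝ) : ∫ x, f (R x) ∂sig = ∫ x, f x ∂sig :=
  (sig_inv R).integral_comp R.toHomeomorph.measurableEmbedding f

lemma sphereUnif_eq : sphereUnif = Measure.map (fun x : E3 => (fun i => x i)) sig := by
  rw [sphereUnif, sig, Measure.map_smul]

lemma exists_rot (i j : Fin 3) (hij : i ≠ j) (t : ℝ) : ∃ R : E3 ≃ₗᵢ[ℝ] E3, ∀ x, 
    R x i = Real.cos t * x i - Real.sin t * x j ∧ R x j = Real.sin t * x i + Real.cos t * x j := by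
  let L : E3 →ₗ[ℝ] E3 := 
    { toFun := fun x => WithLp.toLp 2 (fun l => if l = i then Real.cos t * x i - Real.sin t * x j else
        if l = j then Real.sin t * x i + Real.cos t * x j else x l)
      map_add' := by
        intro x y; ext l; simp; split_ifs <;> ring
      map_smul' := by
        intro x y; ext l; simp; split_ifs <;> ring }
  have hn : ∀ x, ‖L x‖ = ‖x‖ := by
    intro x
    rw [EuclideanSpace.norm_eq, EuclideanSpace.norm_eq]
    congr 1
    have := Real.sin_sq_add_cos_sq t
    fin_cases i <;> fin_cases j <;> simp [L, Fin.sum_univ_three] at hij ⊢ <;> grind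
  let L' : E3 →ₗᵢ[ℝ] E3 := ⟨L, hn⟩
  refine ⟨L'.toLinearIsometryEquiv rfl, fun x => ⟨?_, ?_⟩⟩
  · simp [L', L]
  · simp [L', L, hij.symm]

lemma coord_le {x : E3} (hx : ‖x‖ = 1) (i : Fin 3) : |x i| ≤ 1 := by
  have := PiLp.norm_apply_le x i
  rwa [hx, Real.norm_eq_abs] at this

lemma sum_sq {x : E3} (hx : ‖x‖ = 1) : x 0 ^ 2 + x 1 ^ 2 + x 2 ^ 2 = 1 := by
  have h2 := EuclideanSpace.norm_sq_eq x
  rw [hx] at h2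
  simp [Fin.sum_univ_three] at h2
  linarith

lemma sig_integrable {f : E3 → ℝ} (hf : Continuous f) : Integrable f sig := by
  obtain ⟨C, hC⟩ := (isCompact_sphere (0 : E3) 1).exists_bound_of_continuousOn hf.continuousOn
  refine Integrable.of_bound hf.aestronglyMeasurable C ?_
  filter_upwards [sig_sphere] with x hx
  exact hC x (by simpa using hx)

lemma moment_ij (i j : Fin 3) (hij : i ≠ j) (k : ℕ) :
    ∫ x, (x i ^ (k + 2) - (k + 1) * x i ^ k * x j ^ 2) ∂sig = 0 := by
  let a : ℝ → E3 → ℝ := fun t x => Real.cos t * x i - Real.sin t * x j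
  let b : ℝ → E3 → ℝ := fun t x => Real.sin t * x i + Real.cos t * x j
  have ha : ∀ t x, HasDerivAt (a · x) (- b t x) t := by
    intro t x
    have := ((Real.hasDerivAt_cos t).mul_const (x i)).sub ((Real.hasDerivAt_sin t).mul_const (x j))
    refine this.congr_deriv ?_
    simp only [b]; ring
  have hb : ∀ t x, HasDerivAt (b · x) (a t x) t := by
    intro t x
    have := ((Real.hasDerivAt_sin t).mul_const (x i)).add ((Real.hasDerivAt_cos t).mul_const (x j))
    refine this.congr_deriv ?_
    simp only [a]; ring
  have hac : ∀ t, Continuous (a t) := by intro t; simp only [a]; fun_prop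
  have hbc : ∀ t, Continuous (b t) := by intro t; simp only [b]; fun_prop
  have hab : ∀ t x, ‖x‖ = 1 → |a t x| ≤ 2 ∧ |b t x| ≤ 2 := by
    intro t x hx
    have h1 := coord_le hx i
    have h2 := coord_le hx j
    have h3 := Real.abs_sin_le_one t
    have h4 := Real.abs_cos_le_one t
    constructor
    · calc |a t x| ≤ |Real.cos t * x i| + |Real.sin t * x j| := abs_sub _ _
        _ ≤ 1 * 1 + 1 * 1 := by rw [abs_mul, abs_mul]; gcongr
        _ = 2 := by norm_num
    · calc |b t x| ≤ |Real.sin t * x i| + |Real.cos t * x j| := abs_add_le _ _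
        _ ≤ 1 * 1 + 1 * 1 := by rw [abs_mul, abs_mul]; gcongr
        _ = 2 := by norm_num
  let F : ℝ → E3 → ℝ := fun t x => b t x * a t x ^ (k + 1)
  let F' : ℝ → E3 → ℝ := fun t x => a t x ^ (k + 2) - (k + 1) * a t x ^ k * b t x ^ 2
  have hF : ∀ t x, HasDerivAt (F · x) (F' t x) t := by
    intro t x
    have := (hb t x).mul ((ha t x).pow (k + 1))
    refine this.congr_deriv ?_
    simp only [F']; push_cast; simp; ring
  have key := hasDerivAt_integral_of_dominated_loc_of_deriv_le (μ := sig) (F := F) (F' := F') (x₀ := 0)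
    (s := Set.univ) (bound := fun _ => 2 ^ (k + 2) + (k + 1) * 2 ^ k * 2 ^ 2) Filter.univ_mem
    (Filter.Eventually.of_forall fun t => ((hbc t).mul ((hac t).pow _)).aestronglyMeasurable)
    (sig_integrable ((hbc 0).mul ((hac 0).pow _)))
    (by
      have : Continuous (F' 0) := by
        have := hac 0; have := hbc 0
        simp only [F']; fun_prop
      exact this.aestronglyMeasurable)
    (by
      filter_upwards [sig_sphere] with x hx t _
      obtain ⟨h1, h2⟩ := hab t x hx
      calc ‖F' t x‖ ≤ |a t x ^ (k + 2)| + |(k + 1) * a t x ^ k * b t x ^ 2| := abs_sub _ _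
        _ = |a t x| ^ (k + 2) + (k + 1) * |a t x| ^ k * |b t x| ^ 2 := by
          rw [abs_mul, abs_mul, abs_pow, abs_pow, abs_pow, abs_of_nonneg (by positivity : (0 : ℝ) ≤ k + 1)]
        _ ≤ _ := by gcongr)
    (integrable_const _)
    (Filter.Eventually.of_forall fun x t _ => hF t x)
  have hconst : (fun t => ∫ x, F t x ∂sig) = fun _ => ∫ x, x j * x i ^ (k + 1) ∂sig := by
    funext t
    obtain ⟨R, hR⟩ := exists_rot i j hij t
    rw [← sig_int_inv R (fun x => x j * x i ^ (k + 1))]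
    congr 1
    funext x
    simp only [F, a, b, (hR x).1, (hR x).2]
  have h2 := key.2
  rw [hconst] at h2
  have h3 := h2.unique (hasDerivAt_const _ _)
  rw [← h3]
  congr 1
  funext x
  simp [F', a, b]

lemma moment_rec (i : Fin 3) (k : ℕ) :
    (k + 3) * ∫ x, x i ^ (k + 2) ∂sig = (k + 1) * ∫ x, x i ^ k ∂sig := by
  have key : ∀ j, i ≠ j → ∫ x, x i ^ (k + 2) ∂sig = (k + 1) * ∫ x, x i ^ k * x j ^ 2 ∂sig := by
    intro j hij
    have := moment_ij i j hij k
    rw [integral_sub (sig_integrable (by fun_prop)) (sig_integrable (by fun_prop))] at this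
    rw [← integral_const_mul, sub_eq_zero.1 this]
    simp only [mul_assoc]
  have hs : ∀ j l : Fin 3, i ≠ j → i ≠ l → j ≠ l → ∫ x, x i ^ k ∂sig = ∫ x, x i ^ (k+2) ∂sig + ∫ x, x i ^ k * x j ^ 2 ∂sig + ∫ x, x i ^ k * x l ^ 2 ∂sig := by
    intro j l h1 h2 h3
    rw [← integral_add (sig_integrable (by fun_prop)) (sig_integrable (by fun_prop)),
      ← integral_add (sig_integrable (by fun_prop)) (sig_integrable (by fun_prop))]
    apply integral_congr_ae
    filter_upwards [sig_sphere] with x hx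
    have := sum_sq hx
    have h4 : x i ^ 2 + x j ^ 2 + x l ^ 2 = 1 := by
      fin_cases i <;> fin_cases j <;> fin_cases l <;> simp at h1 h2 h3 ⊢ <;> linarith
    calc x i ^ k = x i ^ k * (x i ^ 2 + x j ^ 2 + x l ^ 2) := by rw [h4, mul_one]
      _ = _ := by ring
  obtain ⟨j, l, h1, h2, h3⟩ : ∃ j l : Fin 3, i ≠ j ∧ i ≠ l ∧ j ≠ l := by
    clear key hs; revert i; decide
  have e1 := key j h1
  have e2 := key l h2
  have e3 := hs j l h1 h2 h3
  rw [e3]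
  linear_combination e1 + e2

instance : IsProbabilityMeasure uniformSymm := by
  constructor
  simp only [uniformSymm, Measure.smul_apply, Measure.restrict_apply_univ, Real.volume_Icc, smul_eq_mul]
  norm_num
  exact ENNReal.inv_mul_cancel (by norm_num) (by norm_num)

lemma unif_int (f : ℝ → ℝ) : ∫ t, f t ∂uniformSymm = (∫ t in (-1)..1, f t) / 2 := by
  rw [uniformSymm, integral_smul_measure, intervalIntegral.integral_of_le (by norm_num), integral_Icc_eq_integral_Ioc]
  simp
  ring

lemma unif_moment (k : ℕ) : ∫ t, t ^ k ∂uniformSymm = (1 - (-1) ^ (k + 1)) / (k + 1) / 2 := by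
  rw [unif_int, integral_pow]; simp

lemma moment_eq (i : Fin 3) (k : ℕ) : ∫ x, x i ^ k ∂sig = ∫ t, t ^ k ∂uniformSymm := by
  rw [unif_moment]
  induction k using Nat.twoStepInduction with
  | zero => simp
  | one =>
    obtain ⟨j, h1⟩ : ∃ j : Fin 3, i ≠ j := by revert i; decide
    obtain ⟨R, hR⟩ := exists_rot i j h1 Real.pi
    have := sig_int_inv R (fun x => x i)
    simp only [(hR _).1] at this
    simp [integral_neg] at this
    simp; linarith
  | more k ih _ =>
    have := moment_rec i k
    rw [ih] at this
    have hk : (k : ℝ) + 3 ≠ 0 := by positivity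
    have hk1 : (k : ℝ) + 1 ≠ 0 := by positivity
    have hk2 : (k : ℝ) + 2 + 1 ≠ 0 := by positivity
    push_cast
    apply mul_left_cancel₀ hk
    rw [this]
    field_simp
    ring

noncomputable def law (i : Fin 3) : Measure ℝ := Measure.map (fun x : E3 => x i) sig

instance (i : Fin 3) : IsProbabilityMeasure (law i) :=
  Measure.isProbabilityMeasure_map (by fun_prop)

lemma law_ae (i : Fin 3) : ∀ᵐ t ∂(law i), t ∈ Set.Icc (-1 : ℝ) 1 := by
  refine (ae_map_iff (p := fun t => t ∈ Set.Icc (-1 : ℝ) 1) (by fun_prop) measurableSet_Icc).2 ?_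
  filter_upwards [sig_sphere] with x hx
  exact abs_le.1 (coord_le hx i)

lemma unif_ae : ∀ᵐ t ∂uniformSymm, t ∈ Set.Icc (-1 : ℝ) 1 :=
  Measure.ae_smul_measure (ae_restrict_mem measurableSet_Icc) _

lemma integrable_of_ae {μ : Measure ℝ} [IsProbabilityMeasure μ] (h : ∀ᵐ t ∂μ, t ∈ Set.Icc (-1 : ℝ) 1)
    {f : ℝ → ℝ} (hf : Continuous f) : Integrable f μ := by
  obtain ⟨C, hC⟩ := (isCompact_Icc (a := (-1 : ℝ)) (b := 1)).exists_bound_of_continuousOn hf.continuousOn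
  refine Integrable.of_bound hf.aestronglyMeasurable C ?_
  filter_upwards [h] with x hx
  exact hC x hx

lemma ext_moments {μ ν : Measure ℝ} [IsProbabilityMeasure μ] [IsProbabilityMeasure ν]
    (hμ : ∀ᵐ t ∂μ, t ∈ Set.Icc (-1 : ℝ) 1) (hν : ∀ᵐ t ∂ν, t ∈ Set.Icc (-1 : ℝ) 1)
    (h : ∀ k : ℕ, ∫ t, t ^ k ∂μ = ∫ t, t ^ k ∂ν) : μ = ν := by
  apply ext_of_forall_integral_eq_of_IsFiniteMeasure
  intro f
  have hp : ∀ p : Polynomial ℝ, ∫ t, p.eval t ∂μ = ∫ t, p.eval t ∂ν := by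
    intro p
    simp only [Polynomial.eval_eq_sum_range]
    rw [integral_finsetSum _ (fun k _ => integrable_of_ae hμ (by fun_prop)),
      integral_finsetSum _ (fun k _ => integrable_of_ae hν (by fun_prop))]
    simp only [integral_const_mul, h]
  have hb : ∀ (ρ : Measure ℝ) [IsProbabilityMeasure ρ], (∀ᵐ t ∂ρ, t ∈ Set.Icc (-1 : ℝ) 1) →
      ∀ (p : Polynomial ℝ) (ε : ℝ), (∀ x ∈ Set.Icc (-1 : ℝ) 1, |p.eval x - f x| < ε) →
      |∫ t, p.eval t ∂ρ - ∫ t, f t ∂ρ| ≤ ε := by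
    intro ρ _ hρ p ε hpe
    rw [← integral_sub (integrable_of_ae hρ (by fun_prop)) (integrable_of_ae hρ f.continuous)]
    have := norm_integral_le_of_norm_le_const (μ := ρ) (f := fun t => p.eval t - f t) (C := ε) (by
      filter_upwards [hρ] with t ht
      exact (hpe t ht).le)
    simpa using this
  refine eq_of_abs_sub_le_all fun ε hε => ?_
  obtain ⟨p, hpe⟩ := exists_polynomial_near_of_continuousOn (-1) 1 f f.continuous.continuousOn (ε / 2) (half_pos hε)
  have h1 := hb μ hμ p _ hpe
  have h2 := hb ν hν p _ hpe
  rw [hp p] at h1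
  rw [abs_le] at *
  constructor <;> linarith [h1.1, h1.2, h2.1, h2.2]

lemma law_eq (i : Fin 3) : law i = uniformSymm := by
  refine ext_moments (law_ae i) unif_ae fun k => ?_
  rw [law, integral_map (by fun_prop) (by fun_prop)]
  exact moment_eq i k

lemma int_sqrt : ∫ t, √(2 - 2 * t) ∂uniformSymm = 4 / 3 := by
  rw [unif_int]
  have h : ∫ t in (-1 : ℝ)..1, √(2 - 2 * t) = 8 / 3 := by
    rw [intervalIntegral.integral_comp_sub_mul (fun u => √u) (by norm_num : (2 : ℝ) ≠ 0)]
    simp only [Real.sqrt_eq_rpow]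
    rw [integral_rpow (by norm_num)]
    have : (2 - 2 * -1 : ℝ) ^ (1 / 2 + 1 : ℝ) = 8 := by
      rw [show (2 - 2 * -1 : ℝ) = 2 ^ (2 : ℝ) by norm_num, ← Real.rpow_mul (by norm_num)]
      norm_num
    rw [this]
    norm_num
  rw [h]; norm_num

lemma inner_int {x : E3} (hx : ‖x‖ = 1) : ∫ y, ‖x - y‖ ∂sig = 4 / 3 := by
  let e : E3 := EuclideanSpace.single 0 1
  have he : ‖x‖ = ‖e‖ := by simp [e, hx]
  let R := Submodule.reflection (ℝ ∙ (x - e))ᗮ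
  have hR : R x = e := Submodule.reflection_sub he
  have h1 : ∫ y, ‖x - y‖ ∂sig = ∫ y, ‖e - y‖ ∂sig := by
    rw [← sig_int_inv R (fun y => ‖e - y‖)]
    congr 1
    funext y
    rw [← hR, ← map_sub, LinearIsometryEquiv.norm_map]
  rw [h1, ← int_sqrt, ← law_eq 0, law, integral_map (by fun_prop) (by fun_prop)]
  apply integral_congr_ae
  filter_upwards [sig_sphere] with y hy
  rw [EuclideanSpace.norm_eq]
  congr 1
  have := sum_sq hy
  simp [Fin.sum_univ_three, e]
  linarith

lemma dist2_eq (x y : E3) : dist2 (fun i => x i) (fun i => y i) = ‖x - y‖ := by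
  simp [dist2, EuclideanSpace.norm_eq]

lemma S_unif : S 3 sphereUnif sphereUnif = 4 / 3 := by
  have hm : MeasurableEmbedding (fun x : E3 => (fun i => x i)) :=
    Continuous.measurableEmbedding (by fun_prop) (fun x y h => by
      ext i; exact congrFun h i)
  rw [S, sphereUnif_eq, hm.integral_map]
  simp only [hm.integral_map, dist2_eq]
  rw [integral_congr_ae (g := fun _ => 4 / 3) (by
    filter_upwards [sig_sphere] with x hx using inner_int hx)]
  simp

lemma S_circ : S 3 CCirc3 CCirc3 = 2 / 3 := by
  have hm : MeasurableEmbedding (fun x : Fin 3 → ℝ => fun i => (x i + 1) / 2) :=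
    Continuous.measurableEmbedding (by fun_prop) (fun x y h => by
      ext i; have := congrFun h i; simp at this; linarith)
  have hd : ∀ x y : Fin 3 → ℝ, dist2 (fun i => (x i + 1) / 2) (fun i => (y i + 1) / 2) = (1 / 2) * dist2 x y := by
    intro x y
    simp only [dist2]
    rw [show (1 / 2 : ℝ) = √((1 / 2) ^ 2) by rw [Real.sqrt_sq (by norm_num)], ← Real.sqrt_mul (by positivity),
      Finset.mul_sum]
    congr 1
    apply Finset.sum_congr rfl
    intro i _
    ring
  have := S_unif
  rw [S] at this
  rw [S, CCirc3, hm.integral_map]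
  simp only [hm.integral_map, hd, integral_const_mul, this]
  norm_num

/-- for independent `X, Y` uniform on the unit sphere of `ℝ³`,
`E‖X-Y‖₂ = 4/3`; each coordinate of `X` is uniform on `[-1,1]`; consequently the bound
`S(C,C) ≤ 2/3` for trivariate copulas is attained by the spherical symmetric copula. -/
theorem stmt11 :
    S 3 sphereUnif sphereUnif = 4 / 3 ∧
    (∀ i : Fin 3, Measure.map (fun x => x i) sphereUnif = uniformSymm) ∧
    S 3 CCirc3 CCirc3 = 2 / 3 := by
  refine ⟨S_unif, fun i => ?_, S_circ⟩
  rw [sphereUnif_eq, Measure.map_map (by fun_prop) (by fun_prop)]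
  exact law_eq i
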